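/- Let k be a field, G̃ a finite group, G a normal subgroup of G̃, and M, S finitely generated kG-modules such that S is a homomorphic image of M and M belongs to Filt(Fac(S)). Then Ind_G^{G̃} M belongs to Filt(Fac(Ind_G^{G̃} S)), and the smallest torsion class of finitely generated kG̃-modules containing Ind_G^{G̃} M coincides with the smallest torsion class containing Ind_G^{G̃} S, i.e., T(Ind_G^{G̃} M) = T(Ind_G^{G̃} S). -/

import Mathlib

open scoped TensorProduct

namespace Paper

/-! ### Torsion-theoretic notions over an arbitrary ring -/

section Torsion

variable (R : Type) [Ring R]

/-- `FacCl R C` : quotient modules of finite direct sums of modules in `C`. -/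
def FacCl (C : ModuleCat.{0} R → Prop) (M : ModuleCat.{0} R) : Prop :=
  ∃ (n : ℕ) (N : Fin n → ModuleCat.{0} R), (∀ i, C (N i)) ∧
    ∃ f : ((i : Fin n) → N i) →ₗ[R] M, Function.Surjective f

/-- `SubCl R C` : submodules of finite direct sums of modules in `C`. -/
def SubCl (C : ModuleCat.{0} R → Prop) (M : ModuleCat.{0} R) : Prop :=
  ∃ (n : ℕ) (N : Fin n → ModuleCat.{0} R), (∀ i, C (N i)) ∧
    ∃ f : M →ₗ[R] ((i : Fin n) → N i), Function.Injective f

/-- `AddCl R C` : direct summands of finite direct sums of modules in `C`. -/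
def AddCl (C : ModuleCat.{0} R → Prop) (M : ModuleCat.{0} R) : Prop :=
  ∃ (n : ℕ) (N : Fin n → ModuleCat.{0} R), (∀ i, C (N i)) ∧
    ∃ (s : M →ₗ[R] ((i : Fin n) → N i)) (r : ((i : Fin n) → N i) →ₗ[R] M),
      ∀ m : M, r (s m) = m

/-- `FiltCl R C` : modules having a finite filtration with subquotients in `add C`. -/
def FiltCl (C : ModuleCat.{0} R → Prop) (M : ModuleCat.{0} R) : Prop :=
  ∃ (l : ℕ) (F : Fin (l + 1) → Submodule R M),
    Monotone F ∧ F 0 = ⊥ ∧ F (Fin.last l) = ⊤ ∧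
      ∀ i : Fin l, AddCl R C (ModuleCat.of R
        (↥(F i.succ) ⧸ Submodule.comap (F i.succ).subtype (F i.castSucc)))

/-- A torsion class inside the ambient class `Amb` of modules:  a subclass of `Amb`
closed under quotient modules, finite direct sums and extensions. -/
def IsTorsionClassIn (Amb T : ModuleCat.{0} R → Prop) : Prop :=
  (∀ M, T M → Amb M) ∧
  (∀ (M N : ModuleCat.{0} R) (f : M →ₗ[R] N),
      Amb N → Function.Surjective f → T M → T N) ∧
  (∀ (n : ℕ) (N : Fin n → ModuleCat.{0} R), (∀ i, T (N i)) →
      Amb (ModuleCat.of R ((i : Fin n) → N i)) →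
      T (ModuleCat.of R ((i : Fin n) → N i))) ∧
  (∀ (M : ModuleCat.{0} R) (A : Submodule R M), Amb M →
      T (ModuleCat.of R ↥A) → T (ModuleCat.of R (↥M ⧸ A)) → T M)

/-- A torsion-free class inside the ambient class `Amb` of modules. -/
def IsTorsionFreeClassIn (Amb F : ModuleCat.{0} R → Prop) : Prop :=
  (∀ M, F M → Amb M) ∧
  (∀ (M N : ModuleCat.{0} R) (f : M →ₗ[R] N),
      Amb M → Function.Injective f → F N → F M) ∧
  (∀ (n : ℕ) (N : Fin n → ModuleCat.{0} R), (∀ i, F (N i)) →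
      Amb (ModuleCat.of R ((i : Fin n) → N i)) →
      F (ModuleCat.of R ((i : Fin n) → N i))) ∧
  (∀ (M : ModuleCat.{0} R) (A : Submodule R M), Amb M →
      F (ModuleCat.of R ↥A) → F (ModuleCat.of R (↥M ⧸ A)) → F M)

/-- The smallest torsion class (inside `Amb`) containing the class `C`. -/
def TorsClIn (Amb C : ModuleCat.{0} R → Prop) (M : ModuleCat.{0} R) : Prop :=
  ∀ T : ModuleCat.{0} R → Prop, IsTorsionClassIn R Amb T →
    (∀ X, Amb X → C X → T X) → T M

/-- The smallest torsion-free class (inside `Amb`) containing the class `C`. -/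
def TorfClIn (Amb C : ModuleCat.{0} R → Prop) (M : ModuleCat.{0} R) : Prop :=
  ∀ F : ModuleCat.{0} R → Prop, IsTorsionFreeClassIn R Amb F →
    (∀ X, Amb X → C X → F X) → F M

/-- The ambient class of finitely generated modules. -/
def FGMod (M : ModuleCat.{0} R) : Prop := Module.Finite R M

def ContravariantlyFinite (Amb C : ModuleCat.{0} R → Prop) : Prop :=
  ∀ M : ModuleCat.{0} R, Amb M →
    ∃ X : ModuleCat.{0} R, C X ∧ ∃ f : X →ₗ[R] M,
      ∀ Y : ModuleCat.{0} R, C Y → ∀ g : Y →ₗ[R] M,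
        ∃ h : Y →ₗ[R] X, ∀ y : Y, f (h y) = g y

def CovariantlyFinite (Amb C : ModuleCat.{0} R → Prop) : Prop :=
  ∀ M : ModuleCat.{0} R, Amb M →
    ∃ X : ModuleCat.{0} R, C X ∧ ∃ f : M →ₗ[R] X,
      ∀ Y : ModuleCat.{0} R, C Y → ∀ g : M →ₗ[R] Y,
        ∃ h : X →ₗ[R] Y, ∀ m : M, h (f m) = g m

def FunctoriallyFinite (Amb C : ModuleCat.{0} R → Prop) : Prop :=
  ContravariantlyFinite R Amb C ∧ CovariantlyFinite R Amb C

/-- `M` is (isomorphic to) a direct summand of `W`. -/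
def IsSummandOf (X W : Type) [AddCommGroup X] [Module R X]
    [AddCommGroup W] [Module R W] : Prop :=
  ∃ (s : X →ₗ[R] W) (r : W →ₗ[R] X), ∀ x : X, r (s x) = x

/-- An indecomposable module: nonzero and not the direct sum of two nonzero submodules. -/
def IndecMod (M : Type) [AddCommGroup M] [Module R M] : Prop :=
  Nontrivial M ∧ ∀ A B : Submodule R M, IsCompl A B → A = ⊥ ∨ B = ⊥

/-- A projective cover: a surjection from a projective module with superfluous kernel. -/
def IsProjCover {P V : Type} [AddCommGroup P] [Module R P]
    [AddCommGroup V] [Module R V] (π : P →ₗ[R] V) : Prop :=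
  Module.Projective R P ∧ Function.Surjective π ∧
    ∀ L : Submodule R P, LinearMap.ker π ⊔ L = ⊤ → L = ⊤

/-- An injective envelope: an injection into an injective module with essential image. -/
def IsInjEnv {V I : Type} [AddCommGroup V] [Module R V]
    [AddCommGroup I] [Module R I] (ι : V →ₗ[R] I) : Prop :=
  Module.Injective R I ∧ Function.Injective ι ∧
    ∀ L : Submodule R I, L ≠ ⊥ → L ⊓ LinearMap.range ι ≠ ⊥

/-- A central idempotent. -/
def IsCentralIdem (b : R) : Prop :=
  b * b = b ∧ ∀ a : R, a * b = b * a

/-- A block idempotent: a primitive idempotent of the center. -/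
def IsBlockIdem (b : R) : Prop :=
  b ≠ 0 ∧ IsCentralIdem R b ∧
    ∀ c d : R, IsCentralIdem R c → IsCentralIdem R d →
      c * d = 0 → d * c = 0 → b = c + d → c = 0 ∨ d = 0

/-- The module `U` lies in the block determined by the central idempotent `b`. -/
def LiesIn (b : R) (U : Type) [AddCommGroup U] [Module R U] : Prop :=
  ∀ u : U, b • u = u

/-- The `b`-component `b·M` of a module `M`, for a central idempotent `b`. -/
def blockComp (b : R) (hb : ∀ a : R, a * b = b * a)
    (M : Type) [AddCommGroup M] [Module R M] : Submodule R M where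
  carrier := {m : M | b • m = m}
  add_mem' := by
    intro x y hx hy
    simp only [Set.mem_setOf_eq] at *
    rw [smul_add, hx, hy]
  zero_mem' := by simp
  smul_mem' := by
    intro c m hm
    simp only [Set.mem_setOf_eq] at *
    rw [smul_smul, ← hb c, mul_smul, hm]

/-- The ambient class of finitely generated modules lying in the block of `b`. -/
def BlockFG (b : R) : ModuleCat.{0} R → Prop :=
  fun M => Module.Finite R M ∧ LiesIn R b M

end Torsion

/-! ### Bundled modules with a compatible `k`-structure -/

structure BModule (k R : Type) [CommSemiring k] [Ring R] [Algebra k R] : Type 1 where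
  carrier : Type
  [isAddCommGroup : AddCommGroup carrier]
  [isModuleK : Module k carrier]
  [isModuleR : Module R carrier]
  [isTower : IsScalarTower k R carrier]

attribute [instance] BModule.isAddCommGroup BModule.isModuleK BModule.isModuleR
  BModule.isTower

instance (k R : Type) [CommSemiring k] [Ring R] [Algebra k R] :
    CoeSort (BModule k R) Type :=
  ⟨BModule.carrier⟩

section GroupAlg

variable (k : Type) [Field k]

/-- A brick over a `k`-algebra `R`: a nonzero module all of whose `R`-endomorphisms
are given by scalars in `k`. -/
def IsBrickOver (R : Type) [Ring R] [Algebra k R]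
    (U : Type) [AddCommGroup U] [Module R U] : Prop :=
  Nontrivial U ∧ ∀ f : U →ₗ[R] U, ∃ c : k, ∀ u : U, f u = algebraMap k R c • u

/-- A module which is a finite direct sum of bricks with no nonzero homomorphisms
between non-isomorphic summands. -/
def IsSemibrickModule (R : Type) [Ring R] [Algebra k R]
    (M : Type) [AddCommGroup M] [Module R M] : Prop :=
  ∃ (m : ℕ) (T : Fin m → BModule k R),
    Nonempty (M ≃ₗ[R] ((i : Fin m) → ↥(T i))) ∧
    (∀ i, IsBrickOver k R ↥(T i)) ∧
    ∀ i j, IsEmpty (↥(T i) ≃ₗ[R] ↥(T j)) → ∀ f : ↥(T i) →ₗ[R] ↥(T j), f = 0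

/-- `V` is one-dimensional over `k`. -/
def OneDimOver (V : Type) [AddCommGroup V] [Module k V] : Prop :=
  ∃ v : V, v ≠ 0 ∧ ∀ w : V, ∃ c : k, w = c • v

/-- Triviality of the second group cohomology `H²(Q, kˣ)` (trivial action):
every `2`-cocycle is a `2`-coboundary. -/
def H2Trivial (Q : Type) [Group Q] : Prop :=
  ∀ α : Q → Q → kˣ,
    (∀ a b c : Q, α a b * α (a * b) c = α b c * α a (b * c)) →
    ∃ β : Q → kˣ, ∀ a b : Q, α a b = β a * β b * (β (a * b))⁻¹

/-- The `k`-algebra `R` is basic (for `k` algebraically closed this means that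
every simple module is one-dimensional over `k`). -/
def BasicAlg (R : Type) [Ring R] [Algebra k R] : Prop :=
  ∀ V : BModule k R, IsSimpleModule R ↥V → OneDimOver k ↥V

/-- `P` has exactly `n` isomorphism classes of modules satisfying it. -/
def RepClasses (R : Type) [Ring R] [Algebra k R]
    (P : BModule k R → Prop) (n : ℕ) : Prop :=
  ∃ V : Fin n → BModule k R, (∀ i, P (V i)) ∧
    (∀ i j, i ≠ j → IsEmpty (↥(V i) ≃ₗ[R] ↥(V j))) ∧
    ∀ W : BModule k R, P W → ∃ i, Nonempty (↥W ≃ₗ[R] ↥(V i))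

/-- The ring homomorphism `k[A] → k[B]` induced by a group homomorphism `f : A → B`. -/
noncomputable def MapAlong {A B : Type} [Group A] [Group B] (f : A →* B) :
    MonoidAlgebra k A →+* MonoidAlgebra k B :=
  MonoidAlgebra.mapDomainRingHom k f

/-- The `k[B]`-module `W` restricted along `f : A → B` is isomorphic to the
`k[A]`-module `U`; i.e. `W` is an extending module of `U`. -/
def ExtendsAlong {A B : Type} [Group A] [Group B] (f : A →* B)
    (U : Type) [AddCommGroup U] [Module (MonoidAlgebra k A) U]
    (W : Type) [AddCommGroup W] [Module (MonoidAlgebra k B) W] : Prop :=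
  ∃ φ : U ≃+ W, ∀ (a : MonoidAlgebra k A) (u : U),
    φ (a • u) = MapAlong k f a • φ u

/-- `η : U →+ W` exhibits the `k[B]`-module `W` as the module induced along
`f : A → B` from the `k[A]`-module `U`: `η` is `k[A]`-linear into the restriction
of `W`, and has the universal (left-adjoint) property. -/
def IsInducedUnit {A B : Type} [Group A] [Group B] (f : A →* B)
    (U : Type) [AddCommGroup U] [Module (MonoidAlgebra k A) U]
    (W : Type) [AddCommGroup W] [Module (MonoidAlgebra k B) W]
    (η : U →+ W) : Prop :=
  (∀ (a : MonoidAlgebra k A) (u : U), η (a • u) = MapAlong k f a • η u) ∧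
  ∀ (X : BModule k (MonoidAlgebra k B)) (g : U →+ ↥X),
    (∀ (a : MonoidAlgebra k A) (u : U), g (a • u) = MapAlong k f a • g u) →
    ∃! F : W →ₗ[MonoidAlgebra k B] ↥X, ∀ u : U, F (η u) = g u

/-- `W` is (a realization of) the induced module `Ind` of `U` along `f`. -/
def IsInducedAlong {A B : Type} [Group A] [Group B] (f : A →* B)
    (U : Type) [AddCommGroup U] [Module (MonoidAlgebra k A) U]
    (W : Type) [AddCommGroup W] [Module (MonoidAlgebra k B) W] : Prop :=
  ∃ η : U →+ W, IsInducedUnit k f U W η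

variable (Gt : Type) [Group Gt] (G : Subgroup Gt) [G.Normal]

/-- Conjugation `g ↦ x⁻¹ g x` as a homomorphism of the normal subgroup `G`. -/
def conjHom (x : Gt) : ↥G →* ↥G where
  toFun g := ⟨x⁻¹ * ↑g * x, ‹G.Normal›.conj_mem' (↑g) g.2 x⟩
  map_one' := by
    apply Subtype.ext
    simp
  map_mul' g h := by
    apply Subtype.ext
    push_cast
    group

/-- The `kG`-module `U` is stable under conjugation by `x`, i.e. `ˣU ≅ U`. -/
def IsStableAt (x : Gt) (U : Type) [AddCommGroup U]
    [Module (MonoidAlgebra k ↥G) U] : Prop :=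
  ∃ ψ : U ≃+ U, ∀ (a : MonoidAlgebra k ↥G) (u : U),
    ψ (MapAlong k (conjHom Gt G x) a • u) = a • ψ u

/-- The `kG`-module `U` is `G̃`-stable. -/
def IsGtStable (U : Type) [AddCommGroup U]
    [Module (MonoidAlgebra k ↥G) U] : Prop :=
  ∀ x : Gt, IsStableAt k Gt G x U

/-- The inertia group of an element `b ∈ kG` inside `G̃`:
all `x ∈ G̃` with `x b x⁻¹ = b`. -/
def inertia (b : MonoidAlgebra k ↥G) : Subgroup Gt where
  carrier := {x : Gt | Commute (MonoidAlgebra.of k Gt x) (MapAlong k G.subtype b)}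
  one_mem' := by
    simp only [Set.mem_setOf_eq, map_one]
    exact Commute.one_left _
  mul_mem' := by
    intro a c ha hc
    simp only [Set.mem_setOf_eq, map_mul] at *
    exact ha.mul_left hc
  inv_mem' := by
    intro a ha
    simp only [Set.mem_setOf_eq] at *
    have h1 : MonoidAlgebra.of k Gt a⁻¹ * MonoidAlgebra.of k Gt a = 1 := by
      rw [← map_mul, inv_mul_cancel, map_one]
    have h2 : MonoidAlgebra.of k Gt a * MonoidAlgebra.of k Gt a⁻¹ = 1 := by
      rw [← map_mul, mul_inv_cancel, map_one]
    show MonoidAlgebra.of k Gt a⁻¹ * MapAlong k G.subtype b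
        = MapAlong k G.subtype b * MonoidAlgebra.of k Gt a⁻¹
    calc MonoidAlgebra.of k Gt a⁻¹ * MapAlong k G.subtype b
        = MonoidAlgebra.of k Gt a⁻¹ * MapAlong k G.subtype b *
            (MonoidAlgebra.of k Gt a * MonoidAlgebra.of k Gt a⁻¹) := by
          rw [h2, mul_one]
      _ = MonoidAlgebra.of k Gt a⁻¹ * (MapAlong k G.subtype b * MonoidAlgebra.of k Gt a) *
            MonoidAlgebra.of k Gt a⁻¹ := by noncomm_ring
      _ = MonoidAlgebra.of k Gt a⁻¹ * (MonoidAlgebra.of k Gt a * MapAlong k G.subtype b) *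
            MonoidAlgebra.of k Gt a⁻¹ := by rw [← ha.eq]
      _ = (MonoidAlgebra.of k Gt a⁻¹ * MonoidAlgebra.of k Gt a) *
            (MapAlong k G.subtype b * MonoidAlgebra.of k Gt a⁻¹) := by noncomm_ring
      _ = MapAlong k G.subtype b * MonoidAlgebra.of k Gt a⁻¹ := by
          rw [h1, one_mul]

/-- Relative projectivity of a `k[A]`-module with respect to a subgroup `D ≤ A`:
any `k[A]`-linear surjection onto a quotient admitting a `k[D]`-linear splitting of
a lifting problem admits a `k[A]`-linear solution. -/
def RelProj (A : Type) [Group A] (D : Subgroup A)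
    (U : Type) [AddCommGroup U] [Module (MonoidAlgebra k A) U] : Prop :=
  ∀ (M N : BModule k (MonoidAlgebra k A))
    (f : ↥M →ₗ[MonoidAlgebra k A] ↥N) (g : U →ₗ[MonoidAlgebra k A] ↥N),
    Function.Surjective f →
    (∃ h : U →+ ↥M,
        (∀ (c : k) (u : U),
          h (algebraMap k (MonoidAlgebra k A) c • u)
            = algebraMap k (MonoidAlgebra k A) c • h u) ∧
        (∀ (d : ↥D) (u : U),
          h (MonoidAlgebra.of k A ↑d • u) = MonoidAlgebra.of k A ↑d • h u) ∧
        ∀ u : U, f (h u) = g u) →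
    ∃ h' : U →ₗ[MonoidAlgebra k A] ↥M, ∀ u : U, f (h' u) = g u

/-- `D` is a defect group of the block of `b`: `D` is minimal with respect to
inclusion among subgroups such that every module in the block is relatively
`D`-projective. -/
def IsDefectGroup (A : Type) [Group A] (b : MonoidAlgebra k A)
    (D : Subgroup A) : Prop :=
  (∀ U : BModule k (MonoidAlgebra k A),
      LiesIn (MonoidAlgebra k A) b ↥U → RelProj k A D ↥U) ∧
  ∀ D' : Subgroup A, D' ≤ D →
    (∀ U : BModule k (MonoidAlgebra k A),
        LiesIn (MonoidAlgebra k A) b ↥U → RelProj k A D' ↥U) →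
    D' = D

/-- Left finiteness (inside the ambient class `Amb`) of a module `S`: the smallest
torsion class containing `S` is functorially finite. -/
def IsLeftFiniteIn (R : Type) [Ring R] (Amb : ModuleCat.{0} R → Prop)
    (S : Type) [AddCommGroup S] [Module R S] : Prop :=
  FunctoriallyFinite R Amb (TorsClIn R Amb (fun X => Nonempty (↥X ≃ₗ[R] S)))

/-- `W₂` realizes the tensor product `W₁ ⊗ₖ V` with the diagonal `G̃`-action, where
`V` is a `k[G̃/G]`-module viewed as a `k[G̃]`-module via the projection. -/
def DiagTensorIso
    (W₁ : Type) [AddCommGroup W₁] [Module k W₁] [Module (MonoidAlgebra k Gt) W₁]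
    [IsScalarTower k (MonoidAlgebra k Gt) W₁]
    (V : Type) [AddCommGroup V] [Module k V] [Module (MonoidAlgebra k (Gt ⧸ G)) V]
    [IsScalarTower k (MonoidAlgebra k (Gt ⧸ G)) V]
    (W₂ : Type) [AddCommGroup W₂] [Module k W₂] [Module (MonoidAlgebra k Gt) W₂]
    [IsScalarTower k (MonoidAlgebra k Gt) W₂] : Prop :=
  ∃ θ : (W₁ ⊗[k] V) ≃ₗ[k] W₂,
    ∀ (x : Gt) (w : W₁) (v : V),
      θ ((MonoidAlgebra.of k Gt x • w) ⊗ₜ[k]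
          (MonoidAlgebra.of k (Gt ⧸ G) (QuotientGroup.mk x) • v))
        = MonoidAlgebra.of k Gt x • θ (w ⊗ₜ[k] v)

end GroupAlg


section TraceGeneration

variable {R : Type} [Ring R]

lemma iSup_range_eq_top_of_surjective {P Q S : Type} [AddCommGroup P] [Module R P]
    [AddCommGroup Q] [Module R Q] [AddCommGroup S] [Module R S]
    (hP : ⨆ f : S →ₗ[R] P, LinearMap.range f = ⊤) (g : P →ₗ[R] Q)
    (hg : Function.Surjective g) :
    ⨆ f : S →ₗ[R] Q, LinearMap.range f = ⊤ := by
  rw [eq_top_iff, ← LinearMap.range_eq_top.2 hg, ← Submodule.map_top, ← hP, Submodule.map_iSup]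
  refine iSup_le fun f => ?_
  rw [← LinearMap.range_comp]
  exact le_iSup (fun f : S →ₗ[R] Q => LinearMap.range f) (g ∘ₗ f)

lemma iSup_range_pi_eq_top {n : ℕ} {N : Fin n → Type} [∀ i, AddCommGroup (N i)]
    [∀ i, Module R (N i)] {S : Type} [AddCommGroup S] [Module R S]
    (hN : ∀ i, ⨆ f : S →ₗ[R] N i, LinearMap.range f = ⊤) :
    ⨆ f : S →ₗ[R] ((i : Fin n) → N i), LinearMap.range f = ⊤ := by
  rw [eq_top_iff, ← LinearMap.iSup_range_single R N]
  refine iSup_le fun i => ?_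
  rw [← Submodule.map_top, ← hN i, Submodule.map_iSup]
  refine iSup_le fun f => ?_
  rw [← LinearMap.range_comp]
  exact le_iSup (fun f : S →ₗ[R] ((i : Fin n) → N i) => LinearMap.range f) _

lemma iSup_range_eq_top_of_facCl {S : Type} [AddCommGroup S] [Module R S]
    {X : ModuleCat.{0} R} (hX : FacCl R (fun Y => Nonempty (↥Y ≃ₗ[R] S)) X) :
    ⨆ f : S →ₗ[R] X, LinearMap.range f = ⊤ := by
  obtain ⟨n, N, hN, g, hg⟩ := hX
  refine iSup_range_eq_top_of_surjective (iSup_range_pi_eq_top fun i => ?_) g hg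
  obtain ⟨e⟩ := hN i
  rw [eq_top_iff, ← LinearEquiv.range e.symm]
  exact le_iSup (fun f : S →ₗ[R] N i => LinearMap.range f) e.symm.toLinearMap

lemma iSup_range_eq_top_of_addCl_facCl {S : Type} [AddCommGroup S] [Module R S]
    {X : ModuleCat.{0} R}
    (hX : AddCl R (FacCl R (fun Y => Nonempty (↥Y ≃ₗ[R] S))) X) :
    ⨆ f : S →ₗ[R] X, LinearMap.range f = ⊤ := by
  obtain ⟨n, N, hN, s, r, hr⟩ := hX
  exact iSup_range_eq_top_of_surjective
    (iSup_range_pi_eq_top fun i => iSup_range_eq_top_of_facCl (hN i)) r fun x => ⟨s x, hr x⟩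

lemma facCl_of_iSup_range_eq_top {S : Type} [AddCommGroup S] [Module R S]
    {X : ModuleCat.{0} R} [Module.Finite R X]
    (hX : ⨆ f : S →ₗ[R] X, LinearMap.range f = ⊤) :
    FacCl R (fun Y => Nonempty (↥Y ≃ₗ[R] S)) X := by
  classical
  have hc : IsCompactElement (⊤ : Submodule R X) :=
    (Submodule.fg_iff_compact _).1 Module.Finite.fg_top
  obtain ⟨s, hs⟩ :=
    CompleteLattice.isCompactElement_iff_exists_le_iSup_of_le_iSup _ |>.1 hc _ _ hX.ge
  let e := s.equivFin
  refine ⟨s.card, fun _ => ModuleCat.of R S, fun _ => ⟨LinearEquiv.refl R S⟩,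
    LinearMap.lsum R (fun _ : Fin s.card => S) ℕ fun i => (e.symm i).1, ?_⟩
  rw [← LinearMap.range_eq_top, eq_top_iff]
  refine hs.trans (Finset.sup_le fun f hf => ?_)
  rintro _ ⟨x, rfl⟩
  exact ⟨Pi.single (e ⟨f, hf⟩) x, (LinearMap.lsum_piSingle ..).trans (by simp)⟩

lemma addCl_of_mem {C : ModuleCat.{0} R → Prop} {X : ModuleCat.{0} R} (hX : C X) :
    AddCl R C X :=
  ⟨1, fun _ => X, fun _ => hX, LinearMap.pi fun _ => LinearMap.id, LinearMap.proj 0,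
    fun _ => rfl⟩

lemma IsTorsionClassIn.mem_of_filtCl [IsNoetherianRing R] {T C : ModuleCat.{0} R → Prop}
    (hT : IsTorsionClassIn R (FGMod R) T) (hC : ∀ X, FGMod R X → C X → T X)
    {X : ModuleCat.{0} R} (hX : FGMod R X) (hF : FiltCl R (FacCl R C) X)
    (hCfg : ∀ X, C X → FGMod R X) : T X := by
  obtain ⟨-, hquot, hsum, hext⟩ := hT
  have hpi : ∀ (n : ℕ) (N : Fin n → ModuleCat.{0} R), (∀ i, T (N i)) → (∀ i, FGMod R (N i)) →
      T (ModuleCat.of R ((i : Fin n) → N i)) := by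
    intro n N hN hfg
    have : ∀ i, Module.Finite R (N i) := hfg
    exact hsum n N hN (inferInstanceAs (Module.Finite R ((i : Fin n) → N i)))
  have hfac : ∀ Y, FacCl R C Y → T Y ∧ FGMod R Y := by
    rintro Y ⟨n, N, hN, f, hf⟩
    have : ∀ i, Module.Finite R (N i) := fun i => hCfg _ (hN i)
    have hY : FGMod R Y := Module.Finite.of_surjective f hf
    exact ⟨hquot _ Y f hY hf (hpi n N (fun i => hC _ (hCfg _ (hN i)) (hN i)) this), hY⟩
  have hadd : ∀ Y, AddCl R (FacCl R C) Y → T Y := by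
    rintro Y ⟨n, N, hN, s, r, hr⟩
    have : ∀ i, Module.Finite R (N i) := fun i => (hfac _ (hN i)).2
    have hsur : Function.Surjective r := fun y => ⟨s y, hr y⟩
    exact hquot _ Y r (Module.Finite.of_surjective r hsur) hsur
      (hpi n N (fun i => (hfac _ (hN i)).1) this)
  obtain ⟨l, F, hmono, h0, hl, hstep⟩ := hF
  have : Module.Finite R X := hX
  have : IsNoetherian R X := isNoetherian_of_isNoetherianRing_of_finite R X
  have key : ∀ i : Fin (l + 1), T (ModuleCat.of R (F i)) := by
    intro i
    induction i using Fin.induction with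
    | zero =>
      refine hquot (ModuleCat.of R ((i : Fin 0) → (fun _ => X : Fin 0 → ModuleCat.{0} R) i)) _
        (0 : ((i : Fin 0) → X) →ₗ[R] F 0) (inferInstanceAs (Module.Finite R (F 0))) ?_
        (hpi 0 _ (fun i => i.elim0) fun i => i.elim0)
      rintro ⟨y, hy⟩
      refine ⟨0, Subtype.ext ?_⟩
      rw [h0, Submodule.mem_bot] at hy
      exact hy.symm
    | succ i ih =>
      refine hext (ModuleCat.of R (F i.succ))
        (Submodule.comap (F i.succ).subtype (F i.castSucc))
        (inferInstanceAs (Module.Finite R (F i.succ))) ?_ (hadd _ (hstep i))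
      have e := Submodule.comapSubtypeEquivOfLe (hmono i.castSucc_le_succ)
      exact hquot _ _ e.symm.toLinearMap
        (inferInstanceAs
          (Module.Finite R (Submodule.comap (F i.succ).subtype (F i.castSucc))))
        e.symm.surjective ih
  refine hquot _ X (F (Fin.last l)).subtype hX ?_ (key (Fin.last l))
  rw [← LinearMap.range_eq_top, Submodule.range_subtype, hl]

end TraceGeneration

section Induction

variable {k : Type} [Field k] {A B : Type} [Group A] [Group B] {f : A →* B}

/-- Every module over an algebra carries the `k`-structure of a `BModule`. -/
abbrev BModule.ofModule (k : Type) {R : Type} [Field k] [Ring R] [Algebra k R]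
    (X : Type) [AddCommGroup X] [Module R X] : BModule k R :=
  letI : Module k X := Module.compHom X (algebraMap k R)
  haveI : IsScalarTower k R X := ⟨fun c r x => by
    rw [Algebra.smul_def, mul_smul]; rfl⟩
  ⟨X⟩

lemma IsInducedUnit.exists_lift {U W : Type} [AddCommGroup U] [Module (MonoidAlgebra k A) U]
    [AddCommGroup W] [Module (MonoidAlgebra k B) W] {η : U →+ W}
    (hη : IsInducedUnit k f U W η) {X : Type} [AddCommGroup X] [Module (MonoidAlgebra k B) X]
    (g : U →+ X) (hg : ∀ (a : MonoidAlgebra k A) (u : U), g (a • u) = MapAlong k f a • g u) :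
    ∃ F : W →ₗ[MonoidAlgebra k B] X, ∀ u, F (η u) = g u :=
  (hη.2 (BModule.ofModule k X) g hg).exists

lemma IsInducedUnit.hom_ext {U W : Type} [AddCommGroup U] [Module (MonoidAlgebra k A) U]
    [AddCommGroup W] [Module (MonoidAlgebra k B) W] {η : U →+ W}
    (hη : IsInducedUnit k f U W η) {X : Type} [AddCommGroup X] [Module (MonoidAlgebra k B) X]
    {F F' : W →ₗ[MonoidAlgebra k B] X} (h : ∀ u, F (η u) = F' (η u)) : F = F' := by
  refine (hη.2 (BModule.ofModule k X) (F'.toAddMonoidHom.comp η) fun a u => ?_).unique h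
    fun _ => rfl
  change F' (η (a • u)) = MapAlong k f a • F' (η u)
  rw [hη.1, map_smul]

lemma IsInducedUnit.span_range {U W : Type} [AddCommGroup U] [Module (MonoidAlgebra k A) U]
    [AddCommGroup W] [Module (MonoidAlgebra k B) W] {η : U →+ W}
    (hη : IsInducedUnit k f U W η) :
    Submodule.span (MonoidAlgebra k B) (Set.range η) = ⊤ := by
  rw [← Submodule.ker_mkQ (Submodule.span (MonoidAlgebra k B) (Set.range η)),
    LinearMap.ker_eq_top]
  refine hη.hom_ext fun u => ?_
  rw [Submodule.mkQ_apply, LinearMap.zero_apply, Submodule.Quotient.mk_eq_zero]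
  exact Submodule.subset_span ⟨u, rfl⟩

lemma IsInducedUnit.finite {U W : Type} [AddCommGroup U] [Module (MonoidAlgebra k A) U]
    [AddCommGroup W] [Module (MonoidAlgebra k B) W] {η : U →+ W}
    (hη : IsInducedUnit k f U W η) [Module.Finite (MonoidAlgebra k A) U] :
    Module.Finite (MonoidAlgebra k B) W := by
  classical
  obtain ⟨s, hs⟩ := Module.Finite.fg_top (R := MonoidAlgebra k A) (M := U)
  refine ⟨⟨s.image η, ?_⟩⟩
  rw [eq_top_iff, ← hη.span_range, Submodule.span_le]
  rintro _ ⟨u, rfl⟩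
  have hu : u ∈ Submodule.span (MonoidAlgebra k A) (s : Set U) := hs ▸ Submodule.mem_top
  rw [SetLike.mem_coe]
  induction hu using Submodule.span_induction with
  | mem x hx => exact Submodule.subset_span (by simpa using ⟨x, hx, rfl⟩)
  | zero => rw [map_zero]; exact zero_mem _
  | add x y _ _ hx hy => rw [map_add]; exact add_mem hx hy
  | smul a x _ hx => rw [hη.1]; exact Submodule.smul_mem _ _ hx

lemma IsInducedUnit.exists_surjective {U V WU WV : Type}
    [AddCommGroup U] [Module (MonoidAlgebra k A) U]
    [AddCommGroup V] [Module (MonoidAlgebra k A) V]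
    [AddCommGroup WU] [Module (MonoidAlgebra k B) WU]
    [AddCommGroup WV] [Module (MonoidAlgebra k B) WV] {η : U →+ WU} {θ : V →+ WV}
    (hη : IsInducedUnit k f U WU η) (hθ : IsInducedUnit k f V WV θ)
    (φ : U →ₗ[MonoidAlgebra k A] V) (hφ : Function.Surjective φ) :
    ∃ F : WU →ₗ[MonoidAlgebra k B] WV, Function.Surjective F := by
  obtain ⟨F, hF⟩ := hη.exists_lift (θ.comp φ.toAddMonoidHom) fun a u => by
    change θ (φ (a • u)) = MapAlong k f a • θ (φ u)
    rw [map_smul, hθ.1]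
  refine ⟨F, LinearMap.range_eq_top.1 (eq_top_iff.2 ?_)⟩
  rw [← hθ.span_range, Submodule.span_le]
  rintro _ ⟨v, rfl⟩
  obtain ⟨u, rfl⟩ := hφ v
  exact ⟨η u, hF u⟩

/-- If the image of `ζ : Q → Y` generates `Y`, and `Q` is generated by images of `S`, then `Y` is
generated by images of the module induced from `S`. -/
lemma IsInducedUnit.iSup_range_eq_top {S WS Q Y : Type}
    [AddCommGroup S] [Module (MonoidAlgebra k A) S]
    [AddCommGroup WS] [Module (MonoidAlgebra k B) WS]
    [AddCommGroup Q] [Module (MonoidAlgebra k A) Q]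
    [AddCommGroup Y] [Module (MonoidAlgebra k B) Y] {θ : S →+ WS}
    (hθ : IsInducedUnit k f S WS θ) (ζ : Q →+ Y)
    (hζ : ∀ (a : MonoidAlgebra k A) (q : Q), ζ (a • q) = MapAlong k f a • ζ q)
    (hspan : Submodule.span (MonoidAlgebra k B) (Set.range ζ) = ⊤)
    (hQ : ⨆ g : S →ₗ[MonoidAlgebra k A] Q, LinearMap.range g = ⊤) :
    ⨆ g : WS →ₗ[MonoidAlgebra k B] Y, LinearMap.range g = ⊤ := by
  rw [eq_top_iff, ← hspan, Submodule.span_le]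
  rintro _ ⟨q, rfl⟩
  have hq : q ∈ ⨆ g : S →ₗ[MonoidAlgebra k A] Q, LinearMap.range g := hQ ▸ Submodule.mem_top
  rw [SetLike.mem_coe]
  induction hq using Submodule.iSup_induction' with
  | mem g x hx =>
    obtain ⟨s, rfl⟩ := hx
    obtain ⟨F, hF⟩ := hθ.exists_lift (ζ.comp g.toAddMonoidHom) fun a u => by
      change ζ (g (a • u)) = MapAlong k f a • ζ (g u)
      rw [map_smul, hζ]
    exact le_iSup (fun g : WS →ₗ[MonoidAlgebra k B] Y => LinearMap.range g) F ⟨θ s, hF s⟩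
  | zero => rw [map_zero]; exact zero_mem _
  | add x y _ _ hx hy => rw [map_add]; exact add_mem hx hy

/-- A semilinear map `η` from `U` to `W` sends a subquotient `P / P'` of `U` to the subquotient of
`W` spanned by the images of `P` and `P'`. -/
lemma exists_subquotient_map {U W : Type} [AddCommGroup U] [Module (MonoidAlgebra k A) U]
    [AddCommGroup W] [Module (MonoidAlgebra k B) W] (η : U →+ W)
    (hη : ∀ (a : MonoidAlgebra k A) (u : U), η (a • u) = MapAlong k f a • η u)
    (P' P : Submodule (MonoidAlgebra k A) U) (N' N : Submodule (MonoidAlgebra k B) W)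
    (hN' : N' = Submodule.span _ (η '' P')) (hN : N = Submodule.span _ (η '' P)) :
    ∃ ζ : (P ⧸ P'.comap P.subtype) →+ (N ⧸ N'.comap N.subtype),
      (∀ (a : MonoidAlgebra k A) q, ζ (a • q) = MapAlong k f a • ζ q) ∧
      Submodule.span (MonoidAlgebra k B) (Set.range ζ) = ⊤ := by
  let : Module (MonoidAlgebra k A) (N ⧸ N'.comap N.subtype) :=
    Module.compHom _ (MapAlong k f)
  have hmem : ∀ p : P, η p ∈ N := fun p => hN ▸ Submodule.subset_span ⟨p, p.2, rfl⟩
  let ζ₀ : P →ₗ[MonoidAlgebra k A] (N ⧸ N'.comap N.subtype) :=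
    { toFun := fun p => Submodule.Quotient.mk ⟨η p, hmem p⟩
      map_add' := fun p q => by
        rw [← Submodule.Quotient.mk_add]
        exact congrArg _ (Subtype.ext (map_add η (p : U) q))
      map_smul' := fun a p => by
        change _ = MapAlong k f a • Submodule.Quotient.mk (p := N'.comap N.subtype) _
        rw [← Submodule.Quotient.mk_smul]
        exact congrArg _ (Subtype.ext (hη a p)) }
  have hker : P'.comap P.subtype ≤ LinearMap.ker ζ₀ := fun p hp => by
    rw [LinearMap.mem_ker]
    refine (Submodule.Quotient.mk_eq_zero _).2 ?_
    change η p ∈ N'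
    exact hN' ▸ Submodule.subset_span ⟨p, hp, rfl⟩
  let ζ := (P'.comap P.subtype).liftQ ζ₀ hker
  refine ⟨ζ.toAddMonoidHom, fun a q => ζ.map_smul a q, ?_⟩
  have key : N ≤ ((Submodule.span (MonoidAlgebra k B) (Set.range ζ)).comap
      (N'.comap N.subtype).mkQ).map N.subtype := by
    conv_lhs => rw [hN]
    rw [Submodule.span_le]
    rintro _ ⟨p, hp, rfl⟩
    exact ⟨⟨η p, hmem ⟨p, hp⟩⟩, Submodule.subset_span ⟨Submodule.Quotient.mk ⟨p, hp⟩, rfl⟩, rfl⟩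
  refine eq_top_iff.2 fun y _ => ?_
  obtain ⟨n, rfl⟩ := Submodule.Quotient.mk_surjective _ y
  obtain ⟨n', hn', h⟩ := key n.2
  obtain rfl : n' = n := Subtype.ext h
  exact hn'

lemma IsInducedUnit.filtCl_facCl {U S WU WS : Type}
    [AddCommGroup U] [Module (MonoidAlgebra k A) U]
    [AddCommGroup S] [Module (MonoidAlgebra k A) S]
    [AddCommGroup WU] [Module (MonoidAlgebra k B) WU]
    [AddCommGroup WS] [Module (MonoidAlgebra k B) WS]
    [IsNoetherian (MonoidAlgebra k B) WU] {η : U →+ WU} {θ : S →+ WS}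
    (hη : IsInducedUnit k f U WU η) (hθ : IsInducedUnit k f S WS θ)
    (hU : FiltCl (MonoidAlgebra k A)
      (FacCl (MonoidAlgebra k A) (fun X => Nonempty (↥X ≃ₗ[MonoidAlgebra k A] S)))
      (ModuleCat.of (MonoidAlgebra k A) U)) :
    FiltCl (MonoidAlgebra k B)
      (FacCl (MonoidAlgebra k B) (fun X => Nonempty (↥X ≃ₗ[MonoidAlgebra k B] WS)))
      (ModuleCat.of (MonoidAlgebra k B) WU) := by
  obtain ⟨l, F, hmono, h0, hl, hstep⟩ := hU
  refine ⟨l, fun i => Submodule.span (MonoidAlgebra k B) (η '' (F i : Set U)),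
    fun i j hij => Submodule.span_mono (Set.image_mono (hmono hij)), ?_, ?_, fun i => ?_⟩
  · beta_reduce
    rw [h0, Submodule.span_eq_bot]
    rintro _ ⟨x, hx, rfl⟩
    obtain rfl : x = 0 := hx
    exact map_zero η
  · beta_reduce
    rw [hl]
    change Submodule.span _ (η '' Set.univ) = ⊤
    rw [Set.image_univ, hη.span_range]
  · obtain ⟨ζ, hζ, hspan⟩ := exists_subquotient_map η hη.1 (F i.castSucc) (F i.succ) _ _ rfl rfl
    have : Module.Finite (MonoidAlgebra k B)
      (Submodule.span (MonoidAlgebra k B) (η '' (F i.succ : Set U))) := inferInstance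
    refine addCl_of_mem (@facCl_of_iSup_range_eq_top _ _ _ _ _ _ ?_ ?_)
    · exact Module.Finite.quotient _ _
    · exact hθ.iSup_range_eq_top ζ hζ hspan (iSup_range_eq_top_of_addCl_facCl (hstep i))

end Induction

/-- If `S` is a homomorphic image of `M` and `M ∈ Filt(Fac S)`, then
`Ind M ∈ Filt(Fac (Ind S))` and the smallest torsion classes of finitely generated
`k[G̃]`-modules generated by `Ind M` and by `Ind S` coincide. -/
theorem statement_16 (k : Type) [Field k]
    (Gt : Type) [Group Gt] [Finite Gt] (G : Subgroup Gt) [G.Normal]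
    (M S : Type) [AddCommGroup M] [Module (MonoidAlgebra k ↥G) M]
    [AddCommGroup S] [Module (MonoidAlgebra k ↥G) S]
    [Module.Finite (MonoidAlgebra k ↥G) M] [Module.Finite (MonoidAlgebra k ↥G) S]
    (hsurj : ∃ φ : M →ₗ[MonoidAlgebra k ↥G] S, Function.Surjective φ)
    (hM : FiltCl (MonoidAlgebra k ↥G)
        (FacCl (MonoidAlgebra k ↥G) (fun X => Nonempty (↥X ≃ₗ[MonoidAlgebra k ↥G] S)))
        (ModuleCat.of (MonoidAlgebra k ↥G) M))
    (WM WS : Type) [AddCommGroup WM] [Module (MonoidAlgebra k Gt) WM]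
    [AddCommGroup WS] [Module (MonoidAlgebra k Gt) WS]
    (hWM : IsInducedAlong k G.subtype M WM)
    (hWS : IsInducedAlong k G.subtype S WS) :
    FiltCl (MonoidAlgebra k Gt)
      (FacCl (MonoidAlgebra k Gt) (fun X => Nonempty (↥X ≃ₗ[MonoidAlgebra k Gt] WS)))
      (ModuleCat.of (MonoidAlgebra k Gt) WM) ∧
    ∀ X : ModuleCat.{0} (MonoidAlgebra k Gt),
      TorsClIn (MonoidAlgebra k Gt) (FGMod (MonoidAlgebra k Gt))
        (fun Y => Nonempty (↥Y ≃ₗ[MonoidAlgebra k Gt] WM)) X ↔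
      TorsClIn (MonoidAlgebra k Gt) (FGMod (MonoidAlgebra k Gt))
        (fun Y => Nonempty (↥Y ≃ₗ[MonoidAlgebra k Gt] WS)) X := by
  obtain ⟨η, hη⟩ := hWM
  obtain ⟨θ, hθ⟩ := hWS
  obtain ⟨φ, hφ⟩ := hsurj
  have hWMfin : Module.Finite (MonoidAlgebra k Gt) WM := hη.finite
  have hWSfin : Module.Finite (MonoidAlgebra k Gt) WS := hθ.finite
  have : IsNoetherianRing (MonoidAlgebra k Gt) := IsNoetherianRing.of_finite k _
  have : IsNoetherian (MonoidAlgebra k Gt) WM :=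
    isNoetherian_of_isNoetherianRing_of_finite _ _
  have hfilt := hη.filtCl_facCl hθ hM
  refine ⟨hfilt, fun X => ⟨fun hX T hT hTS => ?_, fun hX T hT hTM => ?_⟩⟩
  · have hTM := hT.mem_of_filtCl hTS (X := ModuleCat.of _ WM) hWMfin hfilt
      fun Y ⟨e⟩ => Module.Finite.equiv e.symm
    exact hX T hT fun Y hY ⟨e⟩ =>
      hT.2.1 (ModuleCat.of _ WM) Y e.symm.toLinearMap hY e.symm.surjective hTM
  · obtain ⟨F, hF⟩ := hη.exists_surjective hθ φ hφ
    have hTWM : T (ModuleCat.of _ WM) := hTM _ hWMfin ⟨LinearEquiv.refl _ _⟩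
    exact hX T hT fun Y hY ⟨e⟩ =>
      hT.2.1 (ModuleCat.of _ WM) Y (e.symm.toLinearMap ∘ₗ F) hY (e.symm.surjective.comp hF) hTWM

end Paper
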